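/- arXiv:1904.01211 — 4 statements merged into one kernel-verified Lean document; each statement's English description precedes it below -/
import Mathlib

section
/- Let (f_m) and f be nondegenerate integrable log-concave functions on ℝⁿ such that f_m → f pointwise. Then max_{0 < s ≤ ‖f_m‖_∞} ξ_{f_m}(s) → max_{0 < s ≤ ‖f‖_∞} ξ_f(s) as m → ∞. Equivalently, max{ e^{-t}·det T : T ∈ S₊, t ∈ ℝ, e^{-t}𝟙_{TB₂ⁿ} ≤ f_m } converges to max{ e^{-t}·det T : T ∈ S₊, t ∈ ℝ, e^{-t}𝟙_{TB₂ⁿ} ≤ f }. -/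
open MeasureTheory Metric Set Filter

noncomputable section

abbrev En (n : ℕ) := EuclideanSpace ℝ (Fin n)

def LogConcaveFn {n : ℕ} (f : En n → ℝ) : Prop :=
  (∀ x, 0 ≤ f x) ∧
  ∀ x y : En n, ∀ l : ℝ, 0 ≤ l → l ≤ 1 →
    f x ^ l * f y ^ (1 - l) ≤ f (l • x + (1 - l) • y)

/-- `ξ_f(s) = s · max{ det T : T ∈ S₊, T B₂ⁿ ⊆ G_f(s) }`. -/
def xiFn {n : ℕ} (f : En n → ℝ) (s : ℝ) : ℝ :=
  s * sSup {d : ℝ | ∃ T : Matrix (Fin n) (Fin n) ℝ, T.PosDef ∧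
    Matrix.toEuclideanLin T '' closedBall (0 : En n) 1 ⊆ {x | s ≤ f x} ∧ d = T.det}

/-- `max{ e^{-t}·det T : T ∈ S₊, t ∈ ℝ, e^{-t}𝟙_{TB₂ⁿ} ≤ f }`. -/
def maxEllip {n : ℕ} (f : En n → ℝ) : ℝ :=
  sSup {v : ℝ | ∃ (T : Matrix (Fin n) (Fin n) ℝ) (t : ℝ), T.PosDef ∧
    (∀ x, (Matrix.toEuclideanLin T '' closedBall (0 : En n) 1).indicator
        (fun _ => Real.exp (-t)) x ≤ f x) ∧
    v = Real.exp (-t) * T.det}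

open scoped Topology

namespace LogConcaveFn

variable {n : ℕ} {f : En n → ℝ}

lemma convex_superlevel (hf : LogConcaveFn f) {c : ℝ} (hc : 0 < c) :
    Convex ℝ {x | c ≤ f x} := by
  rw [convex_iff_forall_pos]
  intro x hx y hy a b ha hb hab
  obtain rfl : b = 1 - a := by linarith
  refine le_trans ?_ (hf.2 x y a ha.le (by linarith))
  calc c = c ^ a * c ^ (1 - a) := by rw [← Real.rpow_add hc]; simp
    _ ≤ f x ^ a * f y ^ (1 - a) := by
      have hx : c ≤ f x := hx
      have hy : c ≤ f y := hy
      have := Real.rpow_nonneg (hf.1 x) a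
      gcongr

lemma eventually_le_on_compact {fm : ℕ → En n → ℝ} (hfm : ∀ m, LogConcaveFn (fm m))
    (hlim : ∀ x, Tendsto (fun m => fm m x) atTop (𝓝 (f x))) {K C : Set (En n)}
    (hK : Convex ℝ K) (hKc : IsCompact K) (hC : C ∈ 𝓝ˢ K) {s s' : ℝ} (hs' : 0 < s')
    (hss : s' < s) (hCs : ∀ x ∈ C, s ≤ f x) :
    ∀ᶠ m in atTop, ∀ x ∈ K, s' ≤ fm m x := by
  obtain ⟨u, hu, huC⟩ := hK.exists_subset_interior_convexHull_finset_of_isCompact hKc hC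
  have h : ∀ᶠ m in atTop, ∀ x ∈ u, s' ≤ fm m x := by
    rw [eventually_all_finset]
    intro x hx
    have := hCs x (huC (subset_convexHull ℝ _ hx))
    filter_upwards [(hlim x).eventually (lt_mem_nhds (hss.trans_le this))] with m hm using hm.le
  filter_upwards [h] with m hm x hx
  exact convexHull_min (fun y hy => hm y hy) ((hfm m).convex_superlevel hs')
    (interior_subset (hu hx))

lemma exists_le_on_closedBall (hf : LogConcaveFn f) (hnd : (interior {x | 0 < f x}).Nonempty) :
    ∃ (x₀ : En n) (r c : ℝ), 0 < r ∧ 0 < c ∧ ∀ x ∈ closedBall x₀ r, c ≤ f x := by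
  obtain ⟨x₀, hx₀⟩ := hnd
  obtain ⟨u, hu, huC⟩ :=
    (convex_singleton (𝕜 := ℝ) x₀).exists_subset_interior_convexHull_finset_of_isCompact
      isCompact_singleton (t := {x | 0 < f x})
      (by rw [nhdsSet_singleton]; exact mem_interior_iff_mem_nhds.1 hx₀)
  have hx₀u : x₀ ∈ interior (convexHull ℝ (u : Set (En n))) := hu rfl
  have hne : u.Nonempty := by
    rw [Finset.nonempty_iff_ne_empty]
    rintro rfl
    simp at hx₀u
  obtain ⟨y, hy, hmin⟩ := u.exists_min_image f hne
  have hc : 0 < f y := huC (subset_convexHull ℝ _ hy)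
  obtain ⟨r, hr, hball⟩ := nhds_basis_closedBall.mem_iff.1 (mem_interior_iff_mem_nhds.1 hx₀u)
  exact ⟨x₀, r, f y, hr, hc, fun x hx =>
    convexHull_min (fun z hz => hmin z hz) (hf.convex_superlevel hc) (hball hx)⟩

lemma sqrt_mul_le_on_closedBall (hf : LogConcaveFn f) {x₀ : En n} {r c : ℝ} (hc : 0 < c)
    (hball : ∀ x ∈ closedBall x₀ r, c ≤ f x) (y w : En n)
    (hw : w ∈ closedBall ((1 / 2 : ℝ) • (y + x₀)) (r / 2)) :
    f y ^ (1 / 2 : ℝ) * c ^ (1 / 2 : ℝ) ≤ f w := by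
  have hz : (2 : ℝ) • w - y ∈ closedBall x₀ r := by
    rw [mem_closedBall, dist_eq_norm] at hw ⊢
    have : (2 : ℝ) • w - y - x₀ = (2 : ℝ) • (w - (1 / 2 : ℝ) • (y + x₀)) := by module
    rw [this, norm_smul, Real.norm_ofNat]
    linarith
  have h := hf.2 y ((2 : ℝ) • w - y) (1 / 2) (by norm_num) (by norm_num)
  have h2 : (1 / 2 : ℝ) • y + (1 - 1 / 2 : ℝ) • ((2 : ℝ) • w - y) = w := by module
  rw [h2, show (1 - 1 / 2 : ℝ) = 1 / 2 by norm_num] at h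
  refine le_trans ?_ h
  have := hball _ hz
  have := Real.rpow_nonneg (hf.1 y) (1 / 2)
  gcongr

lemma sqrt_mul_volume_le (hf : LogConcaveFn f) (hint : Integrable f) {x₀ : En n} {r c : ℝ}
    (hc : 0 < c) (hball : ∀ x ∈ closedBall x₀ r, c ≤ f x) (y : En n) {S : Set (En n)}
    (hsub : closedBall ((1 / 2 : ℝ) • (y + x₀)) (r / 2) ⊆ S) :
    f y ^ (1 / 2 : ℝ) * c ^ (1 / 2 : ℝ) * volume.real (closedBall (0 : En n) (r / 2)) ≤
      ∫ x in S, f x := by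
  have h1 := setIntegral_ge_of_const_le_real (μ := volume) measurableSet_closedBall
    measure_closedBall_lt_top.ne (hf.sqrt_mul_le_on_closedBall hc hball y) hint.integrableOn
  have h2 : volume.real (closedBall ((1 / 2 : ℝ) • (y + x₀)) (r / 2)) =
      volume.real (closedBall (0 : En n) (r / 2)) := by
    simp only [Measure.real]
    rw [Measure.addHaar_closedBall_center]
  rw [h2] at h1
  exact h1.trans (setIntegral_mono_set hint.integrableOn (ae_of_all _ hf.1)
    (ae_of_all _ hsub))

lemma volume_closedBall_pos {r : ℝ} (hr : 0 < r) : 0 < volume.real (closedBall (0 : En n) r) :=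
  ENNReal.toReal_pos (measure_closedBall_pos _ _ hr).ne' measure_closedBall_lt_top.ne

lemma bddAbove_range (hf : LogConcaveFn f) (hint : Integrable f)
    (hnd : (interior {x | 0 < f x}).Nonempty) : BddAbove (range f) := by
  obtain ⟨x₀, r, c, hr, hc, hball⟩ := hf.exists_le_on_closedBall hnd
  set D := c ^ (1 / 2 : ℝ) * volume.real (closedBall (0 : En n) (r / 2)) with hD
  have hDpos : 0 < D := mul_pos (Real.rpow_pos_of_pos hc _) (volume_closedBall_pos (by linarith))
  refine ⟨((∫ x, f x) / D) ^ 2, ?_⟩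
  rintro _ ⟨y, rfl⟩
  have h := hf.sqrt_mul_volume_le hint hc hball y (subset_univ _)
  rw [setIntegral_univ, mul_assoc, ← hD, ← le_div_iff₀ hDpos, ← Real.sqrt_eq_rpow] at h
  exact (Real.sqrt_le_left (le_trans (Real.sqrt_nonneg _) h)).1 h

lemma exists_lt_of_le_norm_sub (hf : LogConcaveFn f) (hint : Integrable f) {x₀ : En n}
    {r c η : ℝ} (hr : 0 < r) (hc : 0 < c) (hη : 0 < η) (hball : ∀ x ∈ closedBall x₀ r, c ≤ f x) :
    ∃ ρ, 0 < ρ ∧ ∀ y, ρ ≤ ‖y - x₀‖ → f y < η := by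
  have htail : Tendsto (fun k : ℕ => ∫ x in {x : En n | (k : ℝ) ≤ ‖x - x₀‖}, f x) atTop (𝓝 0) := by
    have h := tendsto_setIntegral_of_antitone (μ := volume) (f := f)
      (s := fun k : ℕ => {x : En n | (k : ℝ) ≤ ‖x - x₀‖})
      (fun k => measurableSet_le measurable_const (by fun_prop))
      (fun i j hij x (hx : (j : ℝ) ≤ ‖x - x₀‖) =>
        show (i : ℝ) ≤ ‖x - x₀‖ from le_trans (Nat.cast_le.2 hij) hx) ⟨0, hint.integrableOn⟩
    have he : ⋂ k : ℕ, {x : En n | (k : ℝ) ≤ ‖x - x₀‖} = ∅ := by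
      ext x
      obtain ⟨k, hk⟩ := exists_nat_gt ‖x - x₀‖
      simp only [mem_iInter, mem_ofPred_eq, mem_empty_iff_false, iff_false, not_forall, not_le]
      exact ⟨k, hk⟩
    simpa [he] using h
  have hpos : 0 < η ^ (1 / 2 : ℝ) * c ^ (1 / 2 : ℝ) *
      volume.real (closedBall (0 : En n) (r / 2)) :=
    mul_pos (mul_pos (Real.rpow_pos_of_pos hη _) (Real.rpow_pos_of_pos hc _))
      (volume_closedBall_pos (by linarith))
  obtain ⟨k, hk⟩ := (htail.eventually (gt_mem_nhds hpos)).exists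
  refine ⟨2 * k + r, by positivity, fun y hy => ?_⟩
  by_contra! hcon
  have h := hf.sqrt_mul_volume_le hint hc hball y (S := {x : En n | (k : ℝ) ≤ ‖x - x₀‖})
    (fun w hw => by
      rw [mem_closedBall, dist_eq_norm] at hw
      have h1 : ‖(1 / 2 : ℝ) • (y - x₀)‖ = ‖y - x₀‖ / 2 := by
        rw [norm_smul]; norm_num; ring
      have h2 : (1 / 2 : ℝ) • (y - x₀) =
          (w - x₀) - (w - (1 / 2 : ℝ) • (y + x₀)) := by module
      have h3 := norm_sub_le (w - x₀) (w - (1 / 2 : ℝ) • (y + x₀))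
      rw [← h2, h1] at h3
      simp only [mem_ofPred_eq]
      linarith)
  have : η ^ (1 / 2 : ℝ) ≤ f y ^ (1 / 2 : ℝ) := by gcongr
  have : η ^ (1 / 2 : ℝ) * c ^ (1 / 2 : ℝ) * volume.real (closedBall (0 : En n) (r / 2)) ≤
      f y ^ (1 / 2 : ℝ) * c ^ (1 / 2 : ℝ) * volume.real (closedBall (0 : En n) (r / 2)) := by
    gcongr
  linarith

lemma eventually_exp_decay (hf : LogConcaveFn f) (hint : Integrable f)
    (hnd : (interior {x | 0 < f x}).Nonempty) {fm : ℕ → En n → ℝ}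
    (hfm : ∀ m, LogConcaveFn (fm m))
    (hlim : ∀ x, Tendsto (fun m => fm m x) atTop (𝓝 (f x))) :
    ∃ A b R : ℝ, 0 < A ∧ 0 < b ∧
      ∀ᶠ m in atTop, ∀ x, R ≤ ‖x‖ → fm m x ≤ A * Real.exp (-(b * ‖x‖)) := by
  obtain ⟨x₀, r, c, hr, hc, hball⟩ := hf.exists_le_on_closedBall hnd
  have hlow := eventually_le_on_compact hfm hlim (convex_closedBall x₀ (r / 2))
    (isCompact_closedBall x₀ (r / 2)) (C := closedBall x₀ r)
    (mem_nhdsSet_iff_exists.2 ⟨ball x₀ r, isOpen_ball, closedBall_subset_ball (by linarith),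
      ball_subset_closedBall⟩) (s' := c / 2) (by linarith) (by linarith) hball
  have he : 0 < Real.exp (-1) := Real.exp_pos _
  have he1 : Real.exp (-1) < 1 := by simp
  have hη : 0 < c / 2 * Real.exp (-1) := by positivity
  obtain ⟨ρ, hρ, hsmall⟩ := hf.exists_lt_of_le_norm_sub hint hr hc hη hball
  obtain ⟨t, htS, htf, htcov⟩ :=
    (isCompact_sphere x₀ ρ).finite_cover_balls (e := r / 4) (by linarith)
  have hnet : ∀ᶠ m in atTop, ∀ y ∈ t, fm m y < c / 2 * Real.exp (-1) := by
    rw [eventually_all_finite htf]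
    intro y hy
    have h1 : ‖y - x₀‖ = ρ := by simpa [dist_eq_norm] using htS hy
    exact (hlim y).eventually (gt_mem_nhds (hsmall y h1.ge))
  refine ⟨c / 2 * Real.exp (‖x₀‖ / (2 * ρ)), 1 / (2 * ρ), 2 * ρ + ‖x₀‖, by positivity,
    by positivity, ?_⟩
  filter_upwards [hlow, hnet] with m hlow hnet x hx
  have hsphere : ∀ p, ‖p - x₀‖ = 2 * ρ → fm m p < c / 2 * Real.exp (-1) := by
    intro p hp
    by_contra! hcon
    have hz : (1 / 2 : ℝ) • (p + x₀) ∈ sphere x₀ ρ := by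
      rw [mem_sphere, dist_eq_norm,
        show (1 / 2 : ℝ) • (p + x₀) - x₀ = (1 / 2 : ℝ) • (p - x₀) by module, norm_smul, hp]
      norm_num
      ring
    obtain ⟨y, hy, hzy⟩ := mem_iUnion₂.1 (htcov hz)
    have hw : (2 : ℝ) • y - p ∈ closedBall x₀ (r / 2) := by
      rw [mem_ball, dist_comm, dist_eq_norm] at hzy
      rw [mem_closedBall, dist_eq_norm, show (2 : ℝ) • y - p - x₀ =
        (2 : ℝ) • (y - (1 / 2 : ℝ) • (p + x₀)) by module, norm_smul, Real.norm_ofNat]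
      linarith
    have hw' : c / 2 * Real.exp (-1) ≤ fm m ((2 : ℝ) • y - p) :=
      le_trans (by nlinarith) (hlow _ hw)
    have := (hfm m).convex_superlevel hη (show p ∈ _ from hcon) (show _ ∈ _ from hw')
      (a := 1 / 2) (b := 1 / 2) (by norm_num) (by norm_num) (by norm_num)
    rw [show (1 / 2 : ℝ) • p + (1 / 2 : ℝ) • ((2 : ℝ) • y - p) = y by module] at this
    exact absurd (hnet y hy) (not_lt.2 this)
  have hd : ‖x‖ - ‖x₀‖ ≤ ‖x - x₀‖ := norm_sub_norm_le x x₀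
  have hdpos : 0 < ‖x - x₀‖ := by linarith
  set l := 2 * ρ / ‖x - x₀‖ with hl
  have hlpos : 0 < l := by positivity
  have hl1 : l ≤ 1 := (div_le_one hdpos).2 (by linarith)
  have hp : ‖(l • x + (1 - l) • x₀) - x₀‖ = 2 * ρ := by
    rw [show (l • x + (1 - l) • x₀) - x₀ = l • (x - x₀) by module, norm_smul, Real.norm_eq_abs,
      abs_of_pos hlpos, hl, div_mul_cancel₀ _ hdpos.ne']
  have h1 := ((hfm m).2 x x₀ l hlpos.le hl1).trans (hsphere _ hp).le
  have hx₀ : c / 2 ≤ fm m x₀ := hlow x₀ (mem_closedBall_self (by linarith))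
  have h2 : (c / 2) ^ (1 - l) ≤ fm m x₀ ^ (1 - l) := by gcongr
  have h3 : c / 2 * Real.exp (-1) = (c / 2 * Real.exp (-(1 / l))) ^ l * (c / 2) ^ (1 - l) := by
    rw [Real.mul_rpow (by positivity) (by positivity), ← Real.exp_mul]
    have : -(1 / l) * l = -1 := by field_simp
    rw [this, mul_right_comm, ← Real.rpow_add (by positivity)]
    simp
  have h4 : fm m x ^ l ≤ (c / 2 * Real.exp (-(1 / l))) ^ l := by
    refine le_of_mul_le_mul_right ?_ (Real.rpow_pos_of_pos (half_pos hc) (1 - l))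
    rw [← h3]
    refine le_trans ?_ h1
    exact mul_le_mul_of_nonneg_left h2 (Real.rpow_nonneg ((hfm m).1 x) l)
  rw [Real.rpow_le_rpow_iff ((hfm m).1 x) (by positivity) hlpos] at h4
  refine h4.trans ?_
  rw [mul_assoc, ← Real.exp_add]
  gcongr
  rw [hl, one_div_div, ← sub_nonneg]
  have : ‖x₀‖ / (2 * ρ) + -(1 / (2 * ρ) * ‖x‖) - -(‖x - x₀‖ / (2 * ρ)) =
    (‖x - x₀‖ - (‖x‖ - ‖x₀‖)) / (2 * ρ) := by field_simp; ring
  rw [this]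
  exact div_nonneg (by linarith) (by positivity)

end LogConcaveFn

/-- The values `s * det T` of centred ellipsoids `T B₂ⁿ` on which `f` is at least `s`. -/
def ellipsoidValues {n : ℕ} (f : En n → ℝ) : Set ℝ :=
  {v | ∃ (T : Matrix (Fin n) (Fin n) ℝ) (s : ℝ), T.PosDef ∧ 0 < s ∧
    (∀ x ∈ closedBall (0 : En n) 1, s ≤ f (Matrix.toEuclideanLin T x)) ∧ v = s * T.det}

section ellipsoidValues

variable {n : ℕ} {f : En n → ℝ}

lemma maxEllip_eq_sSup_ellipsoidValues (hf : ∀ x, 0 ≤ f x) :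
    maxEllip f = sSup (ellipsoidValues f) := by
  unfold maxEllip ellipsoidValues
  congr 1
  ext v
  constructor
  · rintro ⟨T, t, hT, h, rfl⟩
    refine ⟨T, Real.exp (-t), hT, Real.exp_pos _, fun x hx => ?_, rfl⟩
    have := h (Matrix.toEuclideanLin T x)
    rwa [indicator_of_mem (mem_image_of_mem _ hx)] at this
  · rintro ⟨T, s, hT, hs, h, rfl⟩
    refine ⟨T, -Real.log s, hT, fun x => ?_, by rw [neg_neg, Real.exp_log hs]⟩
    rw [neg_neg, Real.exp_log hs]
    refine indicator_apply_le' ?_ fun _ => hf x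
    rintro ⟨y, hy, rfl⟩
    exact h y hy

lemma pos_of_mem_ellipsoidValues {v : ℝ} (hv : v ∈ ellipsoidValues f) : 0 < v := by
  obtain ⟨T, s, hT, hs, -, rfl⟩ := hv
  exact mul_pos hs hT.det_pos

lemma sSup_ellipsoidValues_nonneg : 0 ≤ sSup (ellipsoidValues f) :=
  Real.sSup_nonneg fun _ hv => (pos_of_mem_ellipsoidValues hv).le

lemma det_le_of_abs_le {T : Matrix (Fin n) (Fin n) ℝ} {C : ℝ} (hT : ∀ i j, |T i j| ≤ C) :
    T.det ≤ n.factorial * C ^ n := by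
  have h := Matrix.det_le (A := T) (abv := AbsoluteValue.abs) (x := C) hT
  simp only [Fintype.card_fin, nsmul_eq_mul] at h
  exact (le_abs_self _).trans h

lemma eventually_abs_entries_le (hf : LogConcaveFn f) (hint : Integrable f)
    (hnd : (interior {x | 0 < f x}).Nonempty) {fm : ℕ → En n → ℝ}
    (hfm : ∀ m, LogConcaveFn (fm m))
    (hlim : ∀ x, Tendsto (fun m => fm m x) atTop (𝓝 (f x))) {c : ℝ} (hc : 0 < c) :
    ∃ C : ℝ, ∀ᶠ m in atTop, ∀ (T : Matrix (Fin n) (Fin n) ℝ) (s : ℝ), T.PosDef →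
      (∀ x ∈ closedBall (0 : En n) 1, s ≤ fm m (Matrix.toEuclideanLin T x)) →
      c ≤ s * T.det → ∀ i j, |T i j| ≤ C := by
  obtain ⟨A, b, R, hA, hb, hdecay⟩ := hf.eventually_exp_decay hint hnd hfm hlim
  have hlim0 : Tendsto (fun x : ℝ => A * n.factorial * (x ^ (n : ℝ) * Real.exp (-b * x)))
      atTop (𝓝 0) := by
    simpa using (tendsto_rpow_mul_exp_neg_mul_atTop_nhds_zero n b hb).const_mul
      (A * n.factorial)
  obtain ⟨C₀, hC₀⟩ := eventually_atTop.1 (hlim0.eventually (gt_mem_nhds hc))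
  refine ⟨max C₀ R, ?_⟩
  filter_upwards [hdecay] with m hdecay T s hT hfeas hcs i₀ j₀
  have : Nonempty (Fin n × Fin n) := ⟨(i₀, j₀)⟩
  obtain ⟨⟨i, j⟩, hmax⟩ := Finite.exists_max fun p : Fin n × Fin n => |T p.1 p.2|
  refine (hmax (i₀, j₀)).trans ?_
  set μ := |T i j| with hμ
  by_contra! hlt
  have hlt1 : C₀ < μ := (le_max_left _ _).trans_lt hlt
  have hlt2 : R < μ := (le_max_right _ _).trans_lt hlt
  have hμ0 : 0 ≤ μ := abs_nonneg _
  set e : En n := EuclideanSpace.single j 1 with he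
  have hs : s ≤ fm m (Matrix.toEuclideanLin T e) := hfeas e (by simp [he])
  have hnorm : μ ≤ ‖Matrix.toEuclideanLin T e‖ := by
    have h := PiLp.norm_apply_le (Matrix.toEuclideanLin T e) i
    have h2 : (Matrix.toEuclideanLin T e) i = T i j := by
      simp [he, Matrix.toLpLin_apply]
    rwa [h2, Real.norm_eq_abs] at h
  have hdet : T.det ≤ n.factorial * μ ^ n := det_le_of_abs_le fun i j => hmax (i, j)
  have h1 := hdecay _ (hlt2.le.trans hnorm)
  have h2 : A * Real.exp (-(b * ‖Matrix.toEuclideanLin T e‖)) ≤ A * Real.exp (-b * μ) := by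
    rw [neg_mul]
    gcongr
  have h3 : s * T.det ≤ A * Real.exp (-b * μ) * (n.factorial * μ ^ n) :=
    mul_le_mul (hs.trans (h1.trans h2)) hdet hT.det_pos.le (by positivity)
  have h4 := hC₀ μ hlt1.le
  rw [Real.rpow_natCast] at h4
  nlinarith

lemma bddAbove_ellipsoidValues (hf : LogConcaveFn f) (hint : Integrable f)
    (hnd : (interior {x | 0 < f x}).Nonempty) : BddAbove (ellipsoidValues f) := by
  obtain ⟨C, hC⟩ := eventually_abs_entries_le hf hint hnd (fm := fun _ => f) (fun _ => hf)
    (fun _ => tendsto_const_nhds) one_pos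
  obtain ⟨-, hC⟩ := hC.exists
  refine ⟨max 1 (f 0 * (n.factorial * C ^ n)), ?_⟩
  rintro _ ⟨T, s, hT, hs, hfeas, rfl⟩
  rcases le_total (s * T.det) 1 with h | h
  · exact h.trans (le_max_left _ _)
  · refine le_trans ?_ (le_max_right _ _)
    have h0 : s ≤ f 0 := by simpa using hfeas 0 (by simp)
    exact mul_le_mul h0 (det_le_of_abs_le (hC T s hT hfeas h)) hT.det_pos.le (hf.1 0)

lemma sSup_xiFn_image_eq (hf : LogConcaveFn f) (hint : Integrable f)
    (hnd : (interior {x | 0 < f x}).Nonempty) :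
    sSup (xiFn f '' Ioc 0 (sSup (range f))) = sSup (ellipsoidValues f) := by
  have hbdd := bddAbove_ellipsoidValues hf hint hnd
  have hmem : ∀ s, 0 < s → ∀ d ∈ {d : ℝ | ∃ T : Matrix (Fin n) (Fin n) ℝ, T.PosDef ∧
      Matrix.toEuclideanLin T '' closedBall (0 : En n) 1 ⊆ {x | s ≤ f x} ∧ d = T.det},
      d ≤ sSup (ellipsoidValues f) / s := by
    rintro s hs _ ⟨T, hT, hsub, rfl⟩
    rw [le_div_iff₀ hs, mul_comm]
    exact le_csSup hbdd ⟨T, s, hT, hs, fun x hx => hsub (mem_image_of_mem _ hx), rfl⟩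
  have hxi : ∀ s, 0 < s → xiFn f s ≤ sSup (ellipsoidValues f) := by
    intro s hs
    rw [xiFn, mul_comm, ← le_div_iff₀ hs]
    exact Real.sSup_le (hmem s hs) (div_nonneg sSup_ellipsoidValues_nonneg hs.le)
  have hxi0 : ∀ s, 0 < s → 0 ≤ xiFn f s := by
    intro s hs
    refine mul_nonneg hs.le (Real.sSup_nonneg ?_)
    rintro _ ⟨T, hT, -, rfl⟩
    exact hT.det_pos.le
  refine le_antisymm (Real.sSup_le ?_ sSup_ellipsoidValues_nonneg) (Real.sSup_le ?_ ?_)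
  · rintro _ ⟨s, hs, rfl⟩
    exact hxi s hs.1
  · rintro _ ⟨T, s, hT, hs, hfeas, rfl⟩
    have h0 : s ≤ f 0 := by simpa using hfeas 0 (by simp)
    have hs' : s ≤ sSup (range f) :=
      h0.trans (le_csSup (hf.bddAbove_range hint hnd) (mem_range_self 0))
    have h1 : s * T.det ≤ xiFn f s := by
      refine mul_le_mul_of_nonneg_left (le_csSup ⟨_, hmem s hs⟩ ⟨T, hT, ?_, rfl⟩) hs.le
      rintro _ ⟨x, hx, rfl⟩
      exact hfeas x hx
    refine h1.trans (le_csSup ⟨sSup (ellipsoidValues f), ?_⟩ ⟨s, ⟨hs, hs'⟩, rfl⟩)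
    rintro _ ⟨t, ht, rfl⟩
    exact hxi t ht.1
  · refine Real.sSup_nonneg ?_
    rintro _ ⟨s, hs, rfl⟩
    exact hxi0 s hs.1

lemma eventually_smul_mem_ellipsoidValues {fm : ℕ → En n → ℝ}
    (hfm : ∀ m, LogConcaveFn (fm m))
    (hlim : ∀ x, Tendsto (fun m => fm m x) atTop (𝓝 (f x))) {v : ℝ}
    (hv : v ∈ ellipsoidValues f) {a : ℝ} (ha : 0 < a) (ha1 : a < 1) :
    ∀ᶠ m in atTop, a ^ (n + 1) * v ∈ ellipsoidValues (fm m) := by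
  obtain ⟨T, s, hT, hs, hfeas, rfl⟩ := hv
  set L := Matrix.toEuclideanLin T with hL
  have hsurj : Function.Surjective L := by
    intro y
    refine ⟨Matrix.toEuclideanLin T⁻¹ y, ?_⟩
    have hu : IsUnit T.det := hT.det_pos.ne'.isUnit
    simp [hL, Matrix.toLpLin_apply, Matrix.mulVec_mulVec, Matrix.mul_nonsing_inv T hu]
  have hopen : IsOpenMap L := L.isOpenMap_of_finiteDimensional hsurj
  have hcont : Continuous L := L.continuous_of_finiteDimensional
  have hev := LogConcaveFn.eventually_le_on_compact hfm hlim
    ((convex_closedBall (0 : En n) a).linear_image L)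
    ((isCompact_closedBall (0 : En n) a).image hcont) (C := L '' closedBall 0 1)
    (mem_nhdsSet_iff_exists.2 ⟨L '' ball 0 1, hopen _ isOpen_ball,
      image_mono (closedBall_subset_ball ha1), image_mono ball_subset_closedBall⟩)
    (s := s) (s' := a * s) (by positivity) (by nlinarith)
    (by rintro _ ⟨x, hx, rfl⟩; exact hfeas x hx)
  filter_upwards [hev] with m hm
  refine ⟨a • T, a * s, hT.smul ha, by positivity, fun x hx => ?_, ?_⟩
  · have hax : a • x ∈ closedBall (0 : En n) a := by
      rw [mem_closedBall_zero_iff] at hx ⊢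
      rw [norm_smul, Real.norm_of_nonneg ha.le]
      nlinarith
    have := hm _ (mem_image_of_mem L hax)
    rwa [map_smul] at this ⊢
  · rw [Matrix.det_smul, Fintype.card_fin]
    ring

lemma le_on_ball_of_tendsto {g : ℕ → En n → ℝ}
    (hlim : ∀ x, Tendsto (fun m => g m x) atTop (𝓝 (f x)))
    {T : ℕ → Matrix (Fin n) (Fin n) ℝ} {T₀ : Matrix (Fin n) (Fin n) ℝ} {s : ℕ → ℝ} {s₀ : ℝ}
    (hT : ∀ k, (T k).PosDef) (hT₀ : T₀.det ≠ 0) (hTlim : Tendsto T atTop (𝓝 T₀))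
    (hslim : Tendsto s atTop (𝓝 s₀))
    (hfeas : ∀ k, ∀ x ∈ closedBall (0 : En n) 1, s k ≤ g k (Matrix.toEuclideanLin (T k) x)) :
    ∀ x ∈ ball (0 : En n) 1, s₀ ≤ f (Matrix.toEuclideanLin T₀ x) := by
  intro x hx
  set y := Matrix.toEuclideanLin T₀ x with hy
  have hinv : Tendsto (fun k => (T k)⁻¹) atTop (𝓝 T₀⁻¹) := by
    refine (continuousAt_matrix_inv T₀ ?_).tendsto.comp hTlim
    rw [Ring.inverse_eq_inv']
    exact continuousAt_inv₀ hT₀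
  have hcont : Continuous fun M : Matrix (Fin n) (Fin n) ℝ => Matrix.toEuclideanLin M y :=
    (PiLp.continuous_toLp 2 _).comp (Continuous.matrix_mulVec continuous_id continuous_const)
  have hpre : Tendsto (fun k => Matrix.toEuclideanLin (T k)⁻¹ y) atTop (𝓝 x) := by
    have h := (hcont.tendsto T₀⁻¹).comp hinv
    have hx' : Matrix.toEuclideanLin T₀⁻¹ y = x := by
      simp [hy, Matrix.toLpLin_apply, Matrix.mulVec_mulVec,
        Matrix.nonsing_inv_mul T₀ hT₀.isUnit]
    rwa [hx'] at h
  refine le_of_tendsto_of_tendsto hslim (hlim y) ?_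
  filter_upwards [hpre.eventually (isOpen_ball.mem_nhds hx)] with k hk
  have h := hfeas k _ (ball_subset_closedBall hk)
  have hu : IsUnit (T k).det := (hT k).det_pos.ne'.isUnit
  have hTy : Matrix.toEuclideanLin (T k) (Matrix.toEuclideanLin (T k)⁻¹ y) = y := by
    simp [Matrix.toLpLin_apply, Matrix.mulVec_mulVec, Matrix.mul_nonsing_inv (T k) hu]
  rwa [hTy] at h

lemma posSemidef_of_tendsto {T : ℕ → Matrix (Fin n) (Fin n) ℝ} {T₀ : Matrix (Fin n) (Fin n) ℝ}
    (hT : ∀ k, (T k).PosSemidef) (hlim : Tendsto T atTop (𝓝 T₀)) : T₀.PosSemidef := by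
  refine .of_dotProduct_mulVec_nonneg ?_ fun x => ?_
  · have h1 : Tendsto (fun k => (T k).conjTranspose) atTop (𝓝 T₀.conjTranspose) :=
      (continuous_id.matrix_conjTranspose.tendsto T₀).comp hlim
    simp only [(hT _).isHermitian.eq] at h1
    exact tendsto_nhds_unique h1 hlim
  · have hc : Continuous fun M : Matrix (Fin n) (Fin n) ℝ => star x ⬝ᵥ (M.mulVec x) :=
      continuous_const.dotProduct (continuous_id.matrix_mulVec continuous_const)
    exact ge_of_tendsto' ((hc.tendsto T₀).comp hlim) fun k => (hT k).dotProduct_mulVec_nonneg x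

lemma le_of_forall_pow_mul_le {v L : ℝ} (k : ℕ) (h : ∀ a, 0 < a → a < 1 → a ^ k * v ≤ L) :
    v ≤ L := by
  have hc : Tendsto (fun a : ℝ => a ^ k * v) (𝓝[<] 1) (𝓝 (1 ^ k * v)) :=
    Continuous.tendsto' (by fun_prop) _ _ rfl |>.mono_left nhdsWithin_le_nhds
  rw [one_pow, one_mul] at hc
  refine le_of_tendsto hc ?_
  filter_upwards [Ioo_mem_nhdsLT (zero_lt_one' ℝ)] with a ha using h a ha.1 ha.2

theorem tendsto_sSup_ellipsoidValues (hf : LogConcaveFn f) (hint : Integrable f)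
    (hnd : (interior {x | 0 < f x}).Nonempty) {fm : ℕ → En n → ℝ}
    (hfm : ∀ m, LogConcaveFn (fm m)) (hintm : ∀ m, Integrable (fm m))
    (hndm : ∀ m, (interior {x | 0 < fm m x}).Nonempty)
    (hlim : ∀ x, Tendsto (fun m => fm m x) atTop (𝓝 (f x))) :
    Tendsto (fun m => sSup (ellipsoidValues (fm m))) atTop (𝓝 (sSup (ellipsoidValues f))) := by
  have hbdd := bddAbove_ellipsoidValues hf hint hnd
  have hbddm m := bddAbove_ellipsoidValues (hfm m) (hintm m) (hndm m)
  have hL0 : 0 ≤ sSup (ellipsoidValues f) := sSup_ellipsoidValues_nonneg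
  refine tendsto_order.2 ⟨fun b hb => ?_, fun b hb => ?_⟩
  · rcases lt_or_ge b 0 with hb0 | hb0
    · exact Eventually.of_forall fun m => hb0.trans_le sSup_ellipsoidValues_nonneg
    have hne : (ellipsoidValues f).Nonempty := by
      by_contra hne
      rw [not_nonempty_iff_eq_empty.1 hne, Real.sSup_empty] at hb
      linarith
    obtain ⟨v, hv, hbv⟩ := exists_lt_of_lt_csSup hne hb
    obtain ⟨a, ha, ha1, hav⟩ : ∃ a : ℝ, 0 < a ∧ a < 1 ∧ b < a ^ (n + 1) * v := by
      by_contra! hcon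
      exact absurd (le_of_forall_pow_mul_le (n + 1) hcon) (not_le.2 hbv)
    filter_upwards [eventually_smul_mem_ellipsoidValues hfm hlim hv ha ha1] with m hm
    exact hav.trans_le (le_csSup (hbddm m) hm)
  · obtain ⟨c, hLc, hcb⟩ := exists_between hb
    have hc : 0 < c := hL0.trans_lt hLc
    by_contra hcon
    obtain ⟨C, hC⟩ := eventually_abs_entries_le hf hint hnd hfm hlim hc
    have hf0 : ∀ᶠ m in atTop, fm m 0 ≤ f 0 + 1 :=
      ((hlim 0).eventually (gt_mem_nhds (lt_add_one _))).mono fun _ h => h.le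
    have hfreq : ∃ᶠ m in atTop, ∃ (T : Matrix (Fin n) (Fin n) ℝ) (s : ℝ), T.PosDef ∧
        (∀ x ∈ closedBall (0 : En n) 1, s ≤ fm m (Matrix.toEuclideanLin T x)) ∧
        c ≤ s * T.det ∧ (T, s) ∈
          (univ.pi fun _ => univ.pi fun _ => Icc (-C) C : Set (Fin n → Fin n → ℝ)) ×ˢ
            Icc 0 (f 0 + 1) := by
      refine ((not_eventually.1 hcon).and_eventually (hC.and hf0)).mono ?_
      rintro m ⟨hm, hCm, hm0⟩
      have hlt : c < sSup (ellipsoidValues (fm m)) := hcb.trans_le (not_lt.1 hm)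
      have hne : (ellipsoidValues (fm m)).Nonempty := by
        by_contra hne
        rw [not_nonempty_iff_eq_empty.1 hne, Real.sSup_empty] at hlt
        linarith
      obtain ⟨_, ⟨T, s, hT, hs, hfeas, rfl⟩, hv⟩ := exists_lt_of_lt_csSup hne hlt
      have hs0 : s ≤ fm m 0 := by simpa using hfeas 0 (by simp)
      exact ⟨T, s, hT, hfeas, hv.le, fun i _ j _ => abs_le.1 (hCm T s hT hfeas hv.le i j),
        hs.le, hs0.trans hm0⟩
    obtain ⟨φ, hφ, hP⟩ := extraction_of_frequently_atTop hfreq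
    choose T s hT hfeas hcs hmem using hP
    have hcomp : IsCompact
        ((univ.pi fun _ => univ.pi fun _ => Icc (-C) C : Set (Fin n → Fin n → ℝ)) ×ˢ
          Icc (0 : ℝ) (f 0 + 1)) :=
      (isCompact_univ_pi fun _ => isCompact_univ_pi fun _ => isCompact_Icc).prod isCompact_Icc
    obtain ⟨⟨T₀, s₀⟩, hmem₀, ψ, hψ, hconv⟩ := hcomp.tendsto_subseq hmem
    have hTlim : Tendsto (fun k => T (ψ k)) atTop (𝓝 (T₀ : Matrix (Fin n) (Fin n) ℝ)) :=
      (continuous_fst.tendsto _).comp hconv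
    have hslim : Tendsto (fun k => s (ψ k)) atTop (𝓝 s₀) :=
      (continuous_snd.tendsto _).comp hconv
    have hdetlim : Tendsto (fun k => s (ψ k) * (T (ψ k)).det) atTop
        (𝓝 (s₀ * Matrix.det T₀)) :=
      hslim.mul ((continuous_id.matrix_det.tendsto (T₀ : Matrix (Fin n) (Fin n) ℝ)).comp hTlim)
    have hc₀ : c ≤ s₀ * Matrix.det T₀ := ge_of_tendsto' hdetlim fun k => hcs _
    have hprod : 0 < s₀ * Matrix.det T₀ := hc.trans_le hc₀
    have hdet₀ : Matrix.det T₀ ≠ 0 := right_ne_zero_of_mul hprod.ne'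
    have hs₀ : 0 < s₀ := lt_of_le_of_ne hmem₀.2.1 (left_ne_zero_of_mul hprod.ne').symm
    have hT₀ : Matrix.PosDef T₀ :=
      (posSemidef_of_tendsto (fun k => (hT (ψ k)).posSemidef) hTlim).posDef_iff_det_ne_zero.2
        hdet₀
    have hfeas₀ := le_on_ball_of_tendsto (g := fun k => fm (φ (ψ k)))
      (fun x => (hlim x).comp (hφ.tendsto_atTop.comp hψ.tendsto_atTop))
      (fun k => hT (ψ k)) hdet₀ hTlim hslim fun k => hfeas (ψ k)
    have hle : s₀ * Matrix.det T₀ ≤ sSup (ellipsoidValues f) := by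
      refine le_of_forall_pow_mul_le n fun a ha ha1 => le_csSup hbdd
        ⟨a • Matrix.of T₀, s₀, hT₀.smul ha, hs₀, fun x hx => ?_, ?_⟩
      · have hax : a • x ∈ ball (0 : En n) 1 := by
          rw [mem_closedBall_zero_iff] at hx
          rw [mem_ball_zero_iff, norm_smul, Real.norm_of_nonneg ha.le]
          nlinarith
        have := hfeas₀ _ hax
        rw [map_smul] at this ⊢
        exact this
      · rw [Matrix.det_smul, Fintype.card_fin]
        change _ = s₀ * (a ^ n * Matrix.det T₀)
        ring
    linarith

end ellipsoidValues

/-- if nondegenerate integrable log-concave `f_m → f` pointwise,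
then `max_{0<s≤‖f_m‖_∞} ξ_{f_m}(s) → max_{0<s≤‖f‖_∞} ξ_f(s)`; equivalently, the
maximal value `e^{-t} det T` over feasible ellipsoidal minorants converges. -/
theorem max_xi_convergence {n : ℕ}
    (fm : ℕ → (En n → ℝ)) (f : En n → ℝ)
    (hlcm : ∀ m, LogConcaveFn (fm m))
    (hintm : ∀ m, Integrable (fm m))
    (hndm : ∀ m, (interior {x | 0 < fm m x}).Nonempty)
    (hlc : LogConcaveFn f)
    (hint : Integrable f)
    (hnd : (interior {x | 0 < f x}).Nonempty)
    (hptw : ∀ x, Tendsto (fun m => fm m x) atTop (nhds (f x))) :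
    Tendsto (fun m => sSup (xiFn (fm m) '' Set.Ioc 0 (sSup (Set.range (fm m)))))
      atTop (nhds (sSup (xiFn f '' Set.Ioc 0 (sSup (Set.range f))))) ∧
    Tendsto (fun m => maxEllip (fm m)) atTop (nhds (maxEllip f)) := by
  have h := tendsto_sSup_ellipsoidValues hlc hint hnd hlcm hintm hndm hptw
  constructor
  · simpa only [sSup_xiFn_image_eq hlc hint hnd,
      fun m => sSup_xiFn_image_eq (hlcm m) (hintm m) (hndm m)] using h
  · simpa only [maxEllip_eq_sSup_ellipsoidValues hlc.1,
      fun m => maxEllip_eq_sSup_ellipsoidValues (hlcm m).1] using h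
end
end

section
/- Let f = e^{-ψ} be a nondegenerate integrable log-concave function on ℝⁿ and let (b_m) be a sequence in ℝⁿ with b_m → b ∈ ℝⁿ. Then max{ e^{-t}·det T : T ∈ S₊, t ∈ ℝ, ‖Tx‖₂ − t ≤ ψ(x − b_m) for all x ∈ ℝⁿ } converges, as m → ∞, to max{ e^{-t}·det T : T ∈ S₊, t ∈ ℝ, ‖Tx‖₂ − t ≤ ψ(x − b) for all x ∈ ℝⁿ }. -/
open MeasureTheory Metric Set Filter

noncomputable section

/-- `max{ e^{-t} det T : T ∈ S₊, t ∈ ℝ, ‖Tx‖ - t ≤ ψ(x - b) ∀x }`, where the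
constraint is expressed equivalently as `f(x-b) ≤ e^{t-‖Tx‖}` for `f = e^{-ψ}`. -/
def maxAtCenter {n : ℕ} (f : En n → ℝ) (b : En n) : ℝ :=
  sSup {v : ℝ | ∃ (T : Matrix (Fin n) (Fin n) ℝ) (t : ℝ), T.PosDef ∧
    (∀ x, f (x - b) ≤ Real.exp (t - ‖Matrix.toEuclideanLin T x‖)) ∧
    v = Real.exp (-t) * T.det}

/-- The pair `(T, t)` satisfies the constraint defining `maxAtCenter f b`. -/
def IsFeasible {n : ℕ} (f : En n → ℝ) (b : En n) (T : Matrix (Fin n) (Fin n) ℝ) (t : ℝ) : Prop :=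
  ∀ x, f (x - b) ≤ Real.exp (t - ‖Matrix.toEuclideanLin T x‖)

/-- Moving the center costs at most `‖T (b - b')‖` in the parameter `t`. -/
lemma IsFeasible.translate {n : ℕ} {f : En n → ℝ} {b : En n} {T : Matrix (Fin n) (Fin n) ℝ}
    {t : ℝ} (h : IsFeasible f b T t) {b' : En n} {s : ℝ}
    (hs : ‖Matrix.toEuclideanLin T (b - b')‖ ≤ s) : IsFeasible f b' T (t + s) := by
  intro x
  have h1 := h (x + (b - b'))
  rw [show x + (b - b') - b = x - b' by abel, map_add] at h1
  refine h1.trans (Real.exp_le_exp.2 ?_)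
  have h2 := norm_sub_le (Matrix.toEuclideanLin T x + Matrix.toEuclideanLin T (b - b'))
    (Matrix.toEuclideanLin T (b - b'))
  rw [add_sub_cancel_right] at h2
  linarith

/-- A log-concave function is bounded below by a positive constant on some ball around each
interior point of its support. -/
lemma LogConcaveFn.exists_pos_le_on_closedBall {n : ℕ} {f : En n → ℝ} (hf : LogConcaveFn f)
    {x₀ : En n} (hx₀ : x₀ ∈ interior {x | 0 < f x}) :
    ∃ r > 0, ∃ δ > 0, ∀ x ∈ closedBall x₀ r, δ ≤ f x := by
  obtain ⟨R, hR, hball⟩ := Metric.isOpen_iff.1 isOpen_interior x₀ hx₀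
  have hpos : ∀ x ∈ ball x₀ R, 0 < f x := fun x hx =>
    show x ∈ {x | 0 < f x} from interior_subset (hball hx)
  have hconc : ConcaveOn ℝ (ball x₀ R) fun x => Real.log (f x) := by
    refine ⟨convex_ball x₀ R, fun x hx y hy a c ha hc hac => ?_⟩
    obtain rfl : c = 1 - a := by linarith
    have h1 := hf.2 x y a ha (by linarith)
    have hfx := hpos x hx
    have hfy := hpos y hy
    have h2 := Real.log_le_log (by positivity) h1
    rwa [Real.log_mul (by positivity) (by positivity), Real.log_rpow hfx,
      Real.log_rpow hfy] at h2
  have hcont : ContinuousAt (fun x => Real.log (f x)) x₀ :=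
    (hconc.continuousOn isOpen_ball).continuousAt (ball_mem_nhds x₀ hR)
  have hev : ∀ᶠ x in nhds x₀, Real.log (f x₀) - 1 < Real.log (f x) ∧ x ∈ ball x₀ R :=
    (hcont.eventually (lt_mem_nhds (sub_one_lt _))).and (ball_mem_nhds x₀ hR)
  obtain ⟨r, hr, hsub⟩ := Metric.nhds_basis_closedBall.eventually_iff.1 hev
  refine ⟨r, hr, Real.exp (Real.log (f x₀) - 1), Real.exp_pos _, fun x hx => ?_⟩
  obtain ⟨h1, h2⟩ := hsub hx
  exact ((Real.lt_log_iff_exp_lt (hpos x h2)).1 h1).le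

/-- If `f ≥ δ` on a ball of radius `r`, then `T` has operator norm at most
`(t - log δ) / r` for every feasible `(T, t)`, whatever the center. -/
lemma IsFeasible.norm_apply_le {n : ℕ} {f : En n → ℝ} {b : En n} {T : Matrix (Fin n) (Fin n) ℝ}
    {t : ℝ} (h : IsFeasible f b T t) {x₀ : En n} {r δ : ℝ} (hr : 0 < r) (hδ : 0 < δ)
    (hf : ∀ x ∈ closedBall x₀ r, δ ≤ f x) :
    0 ≤ (t - Real.log δ) / r ∧
      ∀ u, ‖Matrix.toEuclideanLin T u‖ ≤ (t - Real.log δ) / r * ‖u‖ := by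
  have key : ∀ u : En n, ‖u‖ ≤ r →
      ‖Matrix.toEuclideanLin T (x₀ + b + u)‖ ≤ t - Real.log δ := by
    intro u hu
    have h1 := h (x₀ + b + u)
    have h2 := hf (x₀ + u) (by simpa using hu)
    rw [show x₀ + b + u - b = x₀ + u by abel] at h1
    have h3 := (Real.log_le_iff_le_exp hδ).2 (h2.trans h1)
    linarith
  have hK : 0 ≤ t - Real.log δ := (norm_nonneg _).trans (key 0 (by simpa using hr.le))
  have key2 : ∀ u : En n, ‖u‖ ≤ r → ‖Matrix.toEuclideanLin T u‖ ≤ t - Real.log δ := by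
    intro u hu
    have h1 := key u hu
    have h2 := key (-u) (by simpa using hu)
    have h3 := norm_sub_le (Matrix.toEuclideanLin T (x₀ + b + u))
      (Matrix.toEuclideanLin T (x₀ + b + -u))
    rw [← map_sub, show x₀ + b + u - (x₀ + b + -u) = (2 : ℝ) • u by module, map_smul,
      norm_smul, Real.norm_ofNat] at h3
    linarith
  refine ⟨by positivity, fun u => ?_⟩
  rcases eq_or_ne u 0 with rfl | hu
  · simp
  have hu' : 0 < ‖u‖ := norm_pos_iff.2 hu
  have h1 := key2 ((r / ‖u‖) • u) (by
    rw [norm_smul, Real.norm_of_nonneg (by positivity), div_mul_cancel₀ _ hu'.ne'])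
  rw [map_smul, norm_smul, Real.norm_of_nonneg (by positivity)] at h1
  rw [div_mul_eq_mul_div, le_div_iff₀ hr]
  rw [div_mul_eq_mul_div, div_le_iff₀ hu'] at h1
  linarith

lemma det_le_factorial_mul_pow_of_norm_apply_le {n : ℕ} {T : Matrix (Fin n) (Fin n) ℝ} {K : ℝ}
    (h : ∀ u, ‖Matrix.toEuclideanLin T u‖ ≤ K * ‖u‖) : T.det ≤ n.factorial * K ^ n := by
  have hentry : ∀ i j, |T i j| ≤ K := by
    intro i j
    have h1 := (PiLp.norm_apply_le (Matrix.toEuclideanLin T (EuclideanSpace.single j 1)) i).trans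
      (h (EuclideanSpace.single j 1))
    simpa [Matrix.toLpLin_apply] using h1
  have h2 := Matrix.det_le (A := T) (abv := AbsoluteValue.abs) (x := K) hentry
  refine (le_abs_self _).trans ?_
  simpa using h2

/-- The objective values at all centers are bounded, and they decay at least like the inverse of
a bound for the operator norm of `T`. -/
lemma LogConcaveFn.exists_objective_bound {n : ℕ} {f : En n → ℝ} (hf : LogConcaveFn f)
    (hnd : (interior {x | 0 < f x}).Nonempty) :
    ∃ C : ℝ, ∀ (b : En n) (T : Matrix (Fin n) (Fin n) ℝ) (t : ℝ), IsFeasible f b T t →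
      ∃ K, 0 ≤ K ∧ (∀ u, ‖Matrix.toEuclideanLin T u‖ ≤ K * ‖u‖) ∧
        Real.exp (-t) * T.det ≤ C ∧ Real.exp (-t) * T.det * K ≤ C := by
  obtain ⟨x₀, hx₀⟩ := hnd
  obtain ⟨r, hr, δ, hδ, hball⟩ := hf.exists_pos_le_on_closedBall hx₀
  let A : ℕ → ℝ := fun k => δ⁻¹ * n.factorial * (k.factorial / r ^ k)
  refine ⟨max (A n) (A (n + 1)), fun b T t h => ?_⟩
  obtain ⟨hK, hT⟩ := h.norm_apply_le hr hδ hball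
  set K := (t - Real.log δ) / r with hKdef
  have ht : Real.exp (-t) = δ⁻¹ * Real.exp (-(r * K)) := by
    have : r * K = t - Real.log δ := by rw [hKdef]; field_simp
    rw [this, show -t = -Real.log δ + -(t - Real.log δ) by ring, Real.exp_add,
      Real.exp_neg (Real.log δ), Real.exp_log hδ]
  have hpow : ∀ k : ℕ, Real.exp (-(r * K)) * K ^ k ≤ k.factorial / r ^ k := by
    intro k
    have h1 := Real.pow_div_factorial_le_exp (r * K) (by positivity) k
    rw [div_le_iff₀ (by positivity)] at h1
    rw [Real.exp_neg, inv_mul_le_iff₀ (Real.exp_pos _), ← mul_div_assoc,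
      le_div_iff₀ (by positivity), ← mul_pow, mul_comm K r]
    exact h1
  have hmain : Real.exp (-t) * T.det ≤
      δ⁻¹ * n.factorial * (Real.exp (-(r * K)) * K ^ n) := by
    calc Real.exp (-t) * T.det ≤ Real.exp (-t) * (n.factorial * K ^ n) := by
          gcongr
          exact det_le_factorial_mul_pow_of_norm_apply_le hT
      _ = _ := by rw [ht]; ring
  refine ⟨K, hK, hT, ?_, ?_⟩
  · refine le_max_of_le_left (hmain.trans ?_)
    exact mul_le_mul_of_nonneg_left (hpow n) (by positivity)
  · refine le_max_of_le_right ((mul_le_mul_of_nonneg_right hmain hK).trans ?_)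
    calc δ⁻¹ * n.factorial * (Real.exp (-(r * K)) * K ^ n) * K
        = δ⁻¹ * n.factorial * (Real.exp (-(r * K)) * K ^ (n + 1)) := by ring
      _ ≤ _ := mul_le_mul_of_nonneg_left (hpow (n + 1)) (by positivity)

lemma maxAtCenter_nonneg {n : ℕ} (f : En n → ℝ) (b : En n) : 0 ≤ maxAtCenter f b := by
  refine Real.sSup_nonneg ?_
  rintro v ⟨T, t, hT, -, rfl⟩
  exact mul_nonneg (Real.exp_pos _).le hT.det_pos.le

lemma LogConcaveFn.objective_le_maxAtCenter {n : ℕ} {f : En n → ℝ} (hf : LogConcaveFn f)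
    (hnd : (interior {x | 0 < f x}).Nonempty) {b : En n} {T : Matrix (Fin n) (Fin n) ℝ} {t : ℝ}
    (hT : T.PosDef) (h : IsFeasible f b T t) : Real.exp (-t) * T.det ≤ maxAtCenter f b := by
  obtain ⟨C, hC⟩ := hf.exists_objective_bound hnd
  refine le_csSup ⟨C, ?_⟩ ⟨T, t, hT, h, rfl⟩
  rintro v ⟨T', t', -, h', rfl⟩
  obtain ⟨K, -, -, hv, -⟩ := hC b T' t' h'
  exact hv

/-- The effect of moving the center on the objective value. -/
lemma LogConcaveFn.objective_le_maxAtCenter_mul_exp {n : ℕ} {f : En n → ℝ} (hf : LogConcaveFn f)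
    (hnd : (interior {x | 0 < f x}).Nonempty) {b b' : En n} {T : Matrix (Fin n) (Fin n) ℝ}
    {t K : ℝ} (hT : T.PosDef) (h : IsFeasible f b T t)
    (hK : ∀ u, ‖Matrix.toEuclideanLin T u‖ ≤ K * ‖u‖) :
    Real.exp (-t) * T.det ≤ maxAtCenter f b' * Real.exp (K * ‖b - b'‖) := by
  have h1 := hf.objective_le_maxAtCenter hnd hT (h.translate (hK (b - b')))
  calc Real.exp (-t) * T.det
      = Real.exp (-(t + K * ‖b - b'‖)) * T.det * Real.exp (K * ‖b - b'‖) := by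
        rw [mul_right_comm, ← Real.exp_add]; ring_nf
    _ ≤ _ := by gcongr

/-- if `b_m → b`, then the maximal value of `e^{-t} det T` subject
to `‖Tx‖ - t ≤ ψ(x - b_m)` converges to the one subject to `‖Tx‖ - t ≤ ψ(x - b)`. -/
theorem maxAtCenter_convergence {n : ℕ}
    (f : En n → ℝ)
    (hlc : LogConcaveFn f)
    (hint : Integrable f)
    (hnd : (interior {x | 0 < f x}).Nonempty)
    (bm : ℕ → En n) (b : En n)
    (hb : Tendsto bm atTop (nhds b)) :
    Tendsto (fun m => maxAtCenter f (bm m)) atTop (nhds (maxAtCenter f b)) := by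
  obtain ⟨C, hC⟩ := hlc.exists_objective_bound hnd
  have hexp : ∀ K : ℝ, Tendsto (fun m => Real.exp (K * ‖bm m - b‖)) atTop (nhds 1) := by
    intro K
    have h1 : Tendsto (fun m => K * ‖bm m - b‖) atTop (nhds (K * 0)) :=
      (tendsto_iff_norm_sub_tendsto_zero.1 hb).const_mul K
    simpa [Function.comp_def] using (Real.continuous_exp.tendsto _).comp h1
  refine tendsto_order.2 ⟨fun a ha => ?_, fun a ha => ?_⟩
  · rcases lt_or_ge a 0 with ha0 | ha0
    · exact Eventually.of_forall fun m => ha0.trans_le (maxAtCenter_nonneg f _)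
    have hne : {v : ℝ | ∃ (T : Matrix (Fin n) (Fin n) ℝ) (t : ℝ), T.PosDef ∧
        (∀ x, f (x - b) ≤ Real.exp (t - ‖Matrix.toEuclideanLin T x‖)) ∧
        v = Real.exp (-t) * T.det}.Nonempty := by
      by_contra hempty
      rw [Set.not_nonempty_iff_eq_empty] at hempty
      rw [maxAtCenter, hempty, Real.sSup_empty] at ha
      exact ha.not_ge ha0
    obtain ⟨_, ⟨T, t, hT, h, rfl⟩, hav⟩ := exists_lt_of_lt_csSup hne ha
    obtain ⟨K, -, hKT, -, -⟩ := hC b T t h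
    have hlim : Tendsto (fun m => a * Real.exp (K * ‖bm m - b‖)) atTop (nhds a) := by
      simpa using (hexp K).const_mul a
    filter_upwards [hlim.eventually (gt_mem_nhds hav)] with m hm
    have h1 := hlc.objective_le_maxAtCenter_mul_exp hnd (b' := bm m) hT h hKT
    rw [norm_sub_rev] at h1
    exact lt_of_mul_lt_mul_right (hm.trans_le h1) (Real.exp_pos _).le
  · obtain ⟨c, hc, hca⟩ := exists_between ha
    have hF := maxAtCenter_nonneg f b
    have hc0 : 0 < c := hF.trans_lt hc
    have hlim : Tendsto (fun m => maxAtCenter f b * Real.exp (C / c * ‖bm m - b‖)) atTop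
        (nhds (maxAtCenter f b)) := by
      simpa using (hexp (C / c)).const_mul (maxAtCenter f b)
    filter_upwards [hlim.eventually (gt_mem_nhds hc)] with m hm
    refine lt_of_le_of_lt (Real.sSup_le ?_ hc0.le) hca
    rintro _ ⟨T, t, hT, h, rfl⟩
    obtain ⟨K, hK0, hKT, -, hvK⟩ := hC (bm m) T t h
    rcases le_or_gt K (C / c) with hK | hK
    · refine (hlc.objective_le_maxAtCenter_mul_exp hnd (b' := b) hT h hKT).trans
        (le_trans ?_ hm.le)
      gcongr
    · by_contra! hv
      rw [div_lt_iff₀ hc0] at hK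
      nlinarith
end
end

section
/- There exists a nondegenerate integrable log-concave function f on ℝ for which the duality relation between the Löwner and John functions fails at the center b₀ of the Löwner function: namely, for f = e^{-ψ} with ψ(x) = 4x² for x ≤ 0 and ψ(x) = x² for x > 0, the Löwner function is L(f)(x) = e^{-(4/√5)|x − 3/(8√5)| + 1/2}, the polar of L(f) with respect to the point b₀ = 3/(8√5) is (L(f))^{b₀} = e^{-1/2}·𝟙_{[−4/√5, 4/√5] + 3/(8√5)}, and (L(f))^{b₀} ≠ J(f^{b₀}). -/
open MeasureTheory Metric Set

noncomputable section

/-- `ψ(x) = 4x²` for `x ≤ 0` and `ψ(x) = x²` for `x > 0`. -/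
def psiEx (x : ℝ) : ℝ := if x ≤ 0 then 4 * x ^ 2 else x ^ 2

/-- The log-concave function `f = e^{-ψ}` of the counterexample. -/
def fEx (x : ℝ) : ℝ := Real.exp (-psiEx x)

/-- The polar `g^z(y) = inf_{x ∈ supp g} e^{-(x-z)(y-z)}/g(x)` of `g : ℝ → ℝ`
with respect to `z`. -/
def fpolarAt1 (g : ℝ → ℝ) (z y : ℝ) : ℝ :=
  sInf {r : ℝ | ∃ x : ℝ, 0 < g x ∧ r = Real.exp (-((x - z) * (y - z))) / g x}

/-- The center of the Löwner function of `fEx`. -/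
def bEx : ℝ := 3 / (8 * Real.sqrt 5)

/-- The Löwner function `L(f)(x) = e^{-(4/√5)|x - 3/(8√5)| + 1/2}` of `fEx`. -/
def LEx (x : ℝ) : ℝ := Real.exp (1 / 2 - (4 / Real.sqrt 5) * |x - bEx|)

/-- The slope `4/√5` of the Löwner function of `fEx`. -/
def slopeEx : ℝ := 4 / Real.sqrt 5

lemma slopeEx_pos : 0 < slopeEx := by unfold slopeEx; positivity

lemma slopeEx_sq : slopeEx ^ 2 = 16 / 5 := by
  unfold slopeEx
  rw [div_pow, Real.sq_sqrt (by norm_num)]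
  norm_num

lemma bEx_eq : bEx = 3 / 32 * slopeEx := by
  unfold bEx slopeEx
  field_simp
  norm_num

lemma LEx_eq (x : ℝ) : LEx x = Real.exp (1 / 2 - slopeEx * |x - bEx|) := rfl

lemma LEx_pos (x : ℝ) : 0 < LEx x := Real.exp_pos _

lemma fEx_le_LEx (x : ℝ) : fEx x ≤ LEx x := by
  rw [LEx_eq, fEx, Real.exp_le_exp, bEx_eq, psiEx]
  have h1 := slopeEx_pos
  have h2 := slopeEx_sq
  split_ifs with hx
  · rw [abs_of_nonpos (by linarith)]
    nlinarith [sq_nonneg (2 * x + slopeEx / 4)]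
  · push Not at hx
    rcases abs_cases (x - 3 / 32 * slopeEx) with ⟨h, -⟩ | ⟨h, -⟩ <;> rw [h]
    · nlinarith [sq_nonneg (x - slopeEx / 2)]
    · nlinarith [mul_pos hx h1, sq_nonneg x]

lemma integral_exp_sub_abs (a c t : ℝ) :
    ∫ x, Real.exp (t - |a * x + c|) = 2 * Real.exp t / |a| := by
  have h0 : ∫ x : ℝ, Real.exp (-|x|) = 2 := by
    rw [integral_comp_abs (f := fun x => Real.exp (-x)), integral_exp_neg_Ioi_zero, mul_one]
  have h1 := Measure.integral_comp_mul_left (fun x : ℝ => Real.exp (t - |x + c|)) a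
  have h2 := integral_add_right_eq_self (μ := volume) (fun x : ℝ => Real.exp (t - |x|)) c
  have h3 : ∫ x : ℝ, Real.exp (t - |x|) = Real.exp t * 2 := by
    simp_rw [sub_eq_add_neg, Real.exp_add]
    rw [integral_const_mul, h0]
  rw [h1, h2, h3, smul_eq_mul, abs_inv]
  ring

lemma integral_LEx : ∫ x, LEx x = 2 * Real.exp (1 / 2) / slopeEx := by
  have h : ∀ x, LEx x = Real.exp (1 / 2 - |slopeEx * x + -(slopeEx * bEx)|) := by
    intro x
    rw [LEx_eq, ← abs_of_pos slopeEx_pos, ← abs_mul, abs_of_pos slopeEx_pos]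
    ring_nf
  simp_rw [h]
  rw [integral_exp_sub_abs, abs_of_pos slopeEx_pos]

lemma sq_abs_le_of_majorizes {a c t : ℝ}
    (h : ∀ x, fEx x ≤ Real.exp (t - |a * x + c|)) : 5 / 32 * a ^ 2 ≤ t := by
  wlog ha : 0 ≤ a generalizing a c
  · have := @this (-a) (-c) (fun x => by
      rw [show -a * x + -c = -(a * x + c) by ring, abs_neg]
      exact h x) (by linarith)
    simpa using this
  have h1 := h (a / 2)
  have h2 := h (-a / 8)
  rw [fEx, Real.exp_le_exp, psiEx] at h1 h2
  rw [if_pos (by linarith)] at h2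
  have h1' : |a * (a / 2) + c| ≤ t + (a / 2) ^ 2 := by
    split_ifs at h1 with h0
    · have : a = 0 := by linarith
      subst this
      simpa using h1
    · linarith
  have h3 := le_abs_self (a * (a / 2) + c)
  have h4 := neg_le_abs (a * (-a / 8) + c)
  nlinarith

lemma LEx_integral_le {a c t : ℝ} (ha : a ≠ 0)
    (h : ∀ x, fEx x ≤ Real.exp (t - |a * x + c|)) :
    ∫ x, LEx x ≤ ∫ x, Real.exp (t - |a * x + c|) := by
  have ht := sq_abs_le_of_majorizes h
  have ha' := abs_pos.2 ha
  rw [integral_LEx, integral_exp_sub_abs, div_le_div_iff₀ slopeEx_pos ha']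
  have key : |a| ≤ Real.exp (t - 1 / 2) * slopeEx := by
    refine abs_le_of_sq_le_sq' ?_ (by have := slopeEx_pos; positivity) |>.2
    rw [mul_pow, slopeEx_sq, ← Real.exp_nat_mul, sq_abs]
    have := Real.add_one_le_exp (((2 : ℕ) : ℝ) * (t - 1 / 2))
    push_cast at this ⊢
    linarith
  have he : Real.exp t = Real.exp (1 / 2) * Real.exp (t - 1 / 2) := by
    rw [← Real.exp_add]; ring_nf
  rw [he]
  nlinarith [mul_le_mul_of_nonneg_left key (Real.exp_pos (1 / 2)).le]

lemma fpolarAt1_bddBelow (g : ℝ → ℝ) (z y : ℝ) :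
    BddBelow {r : ℝ | ∃ x : ℝ, 0 < g x ∧ r = Real.exp (-((x - z) * (y - z))) / g x} := by
  refine ⟨0, ?_⟩
  rintro r ⟨x, hx, rfl⟩
  positivity

lemma fpolarAt1_nonneg (g : ℝ → ℝ) (z y : ℝ) : 0 ≤ fpolarAt1 g z y := by
  refine Real.sInf_nonneg ?_
  rintro r ⟨x, hx, rfl⟩
  positivity

lemma fpolarAt1_le {g : ℝ → ℝ} (z y : ℝ) {x : ℝ} (hx : 0 < g x) :
    fpolarAt1 g z y ≤ Real.exp (-((x - z) * (y - z))) / g x :=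
  csInf_le (fpolarAt1_bddBelow g z y) ⟨x, hx, rfl⟩

lemma le_fpolarAt1 {g : ℝ → ℝ} {z y r : ℝ} (hg : ∃ x, 0 < g x)
    (h : ∀ x, 0 < g x → r ≤ Real.exp (-((x - z) * (y - z))) / g x) :
    r ≤ fpolarAt1 g z y := by
  obtain ⟨x, hx⟩ := hg
  refine le_csInf ⟨_, x, hx, rfl⟩ ?_
  rintro _ ⟨x, hx, rfl⟩
  exact h x hx

lemma exp_div_LEx (x y : ℝ) : Real.exp (-((x - bEx) * (y - bEx))) / LEx x =
    Real.exp (slopeEx * |x - bEx| - (x - bEx) * (y - bEx) - 1 / 2) := by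
  rw [LEx_eq, ← Real.exp_sub]
  ring_nf

lemma fpolarAt1_LEx_of_mem {y : ℝ} (hy : |y - bEx| ≤ slopeEx) :
    fpolarAt1 LEx bEx y = Real.exp (-(1 / 2)) := by
  apply le_antisymm
  · refine (fpolarAt1_le bEx y (LEx_pos bEx)).trans_eq ?_
    rw [exp_div_LEx]
    simp
  · refine le_fpolarAt1 ⟨0, LEx_pos 0⟩ fun x _ => ?_
    rw [exp_div_LEx, Real.exp_le_exp]
    have h1 := le_abs_self ((x - bEx) * (y - bEx))
    rw [abs_mul] at h1
    nlinarith [mul_le_mul_of_nonneg_left hy (abs_nonneg (x - bEx))]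

lemma fpolarAt1_LEx_of_notMem {y : ℝ} (hy : slopeEx < |y - bEx|) :
    fpolarAt1 LEx bEx y = 0 := by
  refine le_antisymm (le_of_forall_pos_le_add fun ε hε => ?_) (fpolarAt1_nonneg _ _ _)
  have hw : 0 < |y - bEx| := slopeEx_pos.trans hy
  set d := |y - bEx| - slopeEx with hd
  have hd0 : 0 < d := by linarith
  -- move along the ray from `bEx` in the direction of `y - bEx`, up to distance `k`
  obtain ⟨k, hk0, hk⟩ : ∃ k : ℝ, 0 ≤ k ∧ -Real.log ε ≤ k * d :=
    ⟨|Real.log ε| / d, by positivity, by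
      rw [div_mul_cancel₀ _ hd0.ne']; exact neg_le_abs _⟩
  obtain ⟨u, hu1, hu2⟩ : ∃ u : ℝ, |u| = 1 ∧ u * (y - bEx) = |y - bEx| := by
    rcases abs_cases (y - bEx) with ⟨h, -⟩ | ⟨h, -⟩
    · exact ⟨1, by simp, by rw [h, one_mul]⟩
    · exact ⟨-1, by simp, by rw [h]; ring⟩
  refine (fpolarAt1_le bEx y (LEx_pos (bEx + k * u))).trans ?_
  rw [exp_div_LEx, zero_add, ← Real.le_log_iff_exp_le hε, add_sub_cancel_left, abs_mul,
    abs_of_nonneg hk0, hu1, mul_assoc, hu2]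
  nlinarith

lemma fpolarAt1_LEx : fpolarAt1 LEx bEx =
    fun y => (Set.Icc (bEx - 4 / Real.sqrt 5) (bEx + 4 / Real.sqrt 5)).indicator
      (fun _ => Real.exp (-(1 / 2))) y := by
  funext y
  change _ = (Set.Icc (bEx - slopeEx) (bEx + slopeEx)).indicator _ y
  have hiff : y ∈ Set.Icc (bEx - slopeEx) (bEx + slopeEx) ↔ |y - bEx| ≤ slopeEx := by
    rw [Set.mem_Icc, abs_le]
    constructor <;> rintro ⟨h1, h2⟩ <;> constructor <;> linarith
  by_cases hy : |y - bEx| ≤ slopeEx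
  · rw [Set.indicator_of_mem (hiff.2 hy), fpolarAt1_LEx_of_mem hy]
  · rw [Set.indicator_of_notMem (mt hiff.1 hy), fpolarAt1_LEx_of_notMem (not_le.1 hy)]

lemma le_fpolarAt1_fEx {y : ℝ} (h1 : -(1.013 * slopeEx) ≤ y - bEx)
    (h2 : y - bEx ≤ 1.007 * slopeEx) :
    Real.exp (-0.50914) ≤ fpolarAt1 fEx bEx y := by
  refine le_fpolarAt1 ⟨0, Real.exp_pos _⟩ fun x _ => ?_
  rw [fEx, ← Real.exp_sub, Real.exp_le_exp]
  have h3 := slopeEx_pos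
  have h4 := slopeEx_sq
  generalize y - bEx = w at *
  rw [bEx_eq, psiEx]
  generalize slopeEx = α at *
  suffices -0.50914 ≤ (if x ≤ 0 then 4 * x ^ 2 else x ^ 2) - x * w + 3 / 32 * (α * w) by linarith
  have h5 : -(1.013 * 3.2) ≤ α * w := by nlinarith
  have h6 : α * w ≤ 1.007 * 3.2 := by nlinarith
  rcases le_total 0 w with hw | hw
  · have h7 : w ^ 2 ≤ 1.007 * (α * w) := by nlinarith
    have h8 := mul_nonneg h3.le hw
    split_ifs with hx
    · nlinarith [mul_nonneg (neg_nonneg.2 hx) hw, sq_nonneg x]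
    · nlinarith [sq_nonneg (x - w / 2)]
  · have h7 : w ^ 2 ≤ 1.013 * -(α * w) := by nlinarith
    split_ifs with hx
    · nlinarith [sq_nonneg (2 * x - w / 4)]
    · nlinarith [mul_nonneg (not_le.1 hx).le (neg_nonneg.2 hw), sq_nonneg x]

lemma indicator_le_fpolarAt1_fEx (y : ℝ) :
    ((fun x => 1.01 * slopeEx * x + (bEx - 0.003 * slopeEx)) '' Set.Icc (-1 : ℝ) 1).indicator
      (fun _ => Real.exp (-0.50914)) y ≤ fpolarAt1 fEx bEx y := by
  refine Set.indicator_apply_le' (fun hy => ?_) (fun _ => fpolarAt1_nonneg _ _ _)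
  obtain ⟨x, ⟨hx1, hx2⟩, rfl⟩ := hy
  have := slopeEx_pos
  apply le_fpolarAt1_fEx <;> nlinarith

lemma exp_mul_slopeEx_lt :
    Real.exp (-(1 / 2)) * slopeEx < Real.exp (-0.50914) * (1.01 * slopeEx) := by
  have h1 : Real.exp (-0.50914) = Real.exp (-(1 / 2)) * Real.exp (-0.00914) := by
    rw [← Real.exp_add]; norm_num
  have h2 := Real.add_one_le_exp (-0.00914 : ℝ)
  have h3 := mul_pos (Real.exp_pos (-(1 / 2))) slopeEx_pos
  rw [h1]
  nlinarith [mul_le_mul_of_nonneg_left h2 h3.le]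

/-- a counterexample to duality.  For `f = e^{-ψ}` with
`ψ(x) = 4x²` (`x ≤ 0`), `ψ(x) = x²` (`x > 0`): `LEx` is the Löwner function of
`f`; the polar of `LEx` at `b₀ = 3/(8√5)` is `e^{-1/2}·𝟙_{[−4/√5,4/√5]+b₀}`; and
this polar is NOT the John function of `f^{b₀}`. -/
theorem lowner_john_duality_counterexample :
    -- `LEx` majorizes `fEx` …
    (∀ x, fEx x ≤ LEx x) ∧
    -- … and minimizes the integral among all majorizing ellipsoidal functions,
    -- so `LEx` is the Löwner function of `fEx`
    (∀ (a c t : ℝ), a ≠ 0 →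
      (∀ x, fEx x ≤ Real.exp (t - |a * x + c|)) →
      (∫ x, LEx x) ≤ ∫ x, Real.exp (t - |a * x + c|)) ∧
    -- the polar of `LEx` with respect to `b₀` is `e^{-1/2}𝟙_{[b₀-4/√5, b₀+4/√5]}`
    (fpolarAt1 LEx bEx =
      fun y => (Set.Icc (bEx - 4 / Real.sqrt 5) (bEx + 4 / Real.sqrt 5)).indicator
        (fun _ => Real.exp (-(1 / 2))) y) ∧
    -- and `(L(f))^{b₀} ≠ J(f^{b₀})`: for any John-function data of `f^{b₀}`,
    -- the resulting John function differs from the polar of `LEx` at `b₀`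
    (∀ (s a c : ℝ), 0 < s → s ≤ sSup (Set.range (fpolarAt1 fEx bEx)) → a ≠ 0 →
      (∀ y, ((fun x => a * x + c) '' Set.Icc (-1 : ℝ) 1).indicator
          (fun _ => s) y ≤ fpolarAt1 fEx bEx y) →
      (∀ (s' a' c' : ℝ), 0 < s' → s' ≤ sSup (Set.range (fpolarAt1 fEx bEx)) →
        a' ≠ 0 →
        (∀ y, ((fun x => a' * x + c') '' Set.Icc (-1 : ℝ) 1).indicator
            (fun _ => s') y ≤ fpolarAt1 fEx bEx y) →
        s' * |a'| ≤ s * |a|) →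
      fpolarAt1 LEx bEx ≠
        fun y => ((fun x => a * x + c) '' Set.Icc (-1 : ℝ) 1).indicator
          (fun _ => s) y) := by
  refine ⟨fEx_le_LEx, fun a c t ha h => LEx_integral_le ha h, fpolarAt1_LEx, ?_⟩
  intro s a c hs hsup _ _ hmax heq
  have hval : ∀ y ∈ (fun x => a * x + c) '' Set.Icc (-1 : ℝ) 1, fpolarAt1 LEx bEx y = s := by
    intro y hy
    rw [heq]
    exact Set.indicator_of_mem hy _
  have hmem : ∀ x ∈ Set.Icc (-1 : ℝ) 1, |a * x + c - bEx| ≤ slopeEx := by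
    intro x hx
    by_contra! hlt
    have := hval _ ⟨x, hx, rfl⟩
    rw [fpolarAt1_LEx_of_notMem hlt] at this
    exact hs.ne this
  have hseq : Real.exp (-(1 / 2)) = s := by
    have h0 : (0 : ℝ) ∈ Set.Icc (-1 : ℝ) 1 := by simp
    rw [← hval _ ⟨0, h0, rfl⟩, fpolarAt1_LEx_of_mem (hmem 0 h0)]
  have ha : |a| ≤ slopeEx := by
    have h1 := abs_le.1 (hmem 1 (by simp))
    have h2 := abs_le.1 (hmem (-1) (by simp))
    rw [abs_le]
    constructor <;> linarith
  have hslope := slopeEx_pos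
  have hpos : 0 < 1.01 * slopeEx := by positivity
  have hle : Real.exp (-0.50914) ≤ s := by
    rw [← hseq, Real.exp_le_exp]; norm_num
  have hcon := hmax _ _ _ (Real.exp_pos (-0.50914)) (hle.trans hsup) hpos.ne'
    indicator_le_fpolarAt1_fEx
  rw [abs_of_pos hpos, ← hseq] at hcon
  have := mul_le_mul_of_nonneg_left ha (Real.exp_pos (-(1 / 2))).le
  linarith [exp_mul_slopeEx_lt]
end
end

section
/- Let f = e^{-ψ} be a nondegenerate integrable log-concave function where ψ(x) = φ(‖x‖₂) depends only on the Euclidean norm of x, with φ convex. Let a > 0 satisfy a = φ′(n/a) and set t₀ = n − φ(n/a). Then the Löwner function of f is L(f)(x) = e^{-a‖x‖₂ + n − φ(n/a)}; i.e., the pair (A₀, t₀) = (a·Id, n − φ(n/a)) satisfies e^{-a‖x‖₂+t₀} ≥ f(x) for all x and minimizes ∫_{ℝⁿ} e^{-‖Ax‖₂+t} dx among all pairs (A, t) with A an invertible affine map, t ∈ ℝ, and e^{-‖Ax‖₂+t} ≥ f pointwise. -/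
open MeasureTheory Metric Set

noncomputable section

/-- A convex function on the line lies above its tangent lines. -/
theorem ConvexOn.tangent_le_of_hasDerivAt {φ : ℝ → ℝ} (hφ : ConvexOn ℝ Set.univ φ) {x m : ℝ}
    (h : HasDerivAt φ m x) (y : ℝ) : φ x + m * (y - x) ≤ φ y := by
  rcases lt_trichotomy x y with hxy | rfl | hxy
  · have := hφ.le_slope_of_hasDerivAt (mem_univ x) (mem_univ y) hxy h
    rw [slope_def_field, le_div_iff₀ (sub_pos.2 hxy)] at this
    linarith
  · simp
  · have := hφ.slope_le_of_hasDerivAt (mem_univ y) (mem_univ x) hxy h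
    rw [slope_def_field, div_le_iff₀ (sub_pos.2 hxy)] at this
    linarith

/-- The determinant of a linear map that expands norms by a factor at most `C` is bounded
by `C ^ n`. -/
theorem abs_det_le_pow_finrank {E : Type*} [NormedAddCommGroup E] [NormedSpace ℝ E]
    [FiniteDimensional ℝ E] (L : E →ₗ[ℝ] E) {C : ℝ} (hC : 0 ≤ C) (hL : ∀ x, ‖L x‖ ≤ C * ‖x‖) :
    |LinearMap.det L| ≤ C ^ Module.finrank ℝ E := by
  borelize E
  let μ : Measure E := Measure.addHaar
  have hsub : L '' closedBall 0 1 ⊆ closedBall 0 C := by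
    rintro _ ⟨x, hx, rfl⟩
    rw [mem_closedBall_zero_iff] at hx ⊢
    exact (hL x).trans (mul_le_of_le_one_right hC hx)
  have h := measure_mono (μ := μ) hsub
  rw [Measure.addHaar_image_linearMap, Measure.addHaar_closedBall' μ 0 hC,
    ENNReal.mul_le_mul_iff_left (measure_closedBall_pos μ 0 one_pos).ne'
      measure_closedBall_lt_top.ne] at h
  exact (ENNReal.ofReal_le_ofReal_iff (by positivity)).1 h

/-- Change of variables for an invertible affine substitution. -/
theorem integral_comp_linearMap_add {E : Type*} [NormedAddCommGroup E] [NormedSpace ℝ E]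
    [FiniteDimensional ℝ E] [MeasurableSpace E] [BorelSpace E] (μ : Measure E)
    [μ.IsAddHaarMeasure] {L : E →ₗ[ℝ] E} (hL : LinearMap.det L ≠ 0) (c : E) {g : E → ℝ}
    (hg : Continuous g) :
    ∫ x, g (L x + c) ∂μ = |LinearMap.det L|⁻¹ * ∫ x, g x ∂μ := by
  have hcont : Continuous fun y => g (y + c) := by fun_prop
  have hmap := integral_map (μ := μ) L.continuous_of_finiteDimensional.measurable.aemeasurable
    (hcont.aestronglyMeasurable (μ := μ.map L))
  rw [← hmap, Measure.map_linearMap_addHaar_eq_smul_addHaar μ hL, integral_smul_measure,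
    integral_add_right_eq_self g c, ENNReal.toReal_ofReal (abs_nonneg _), abs_inv, smul_eq_mul]

/-- An affine map sending the sphere of radius `r` into the ball of radius `s` has linear part
sending that sphere into the same ball. -/
theorem norm_le_of_norm_add_le {E F : Type*} [NormedAddCommGroup E] [NormedSpace ℝ E]
    [NormedAddCommGroup F] [NormedSpace ℝ F] (L : E →ₗ[ℝ] F) (c : F) {r s : ℝ}
    (h : ∀ x, ‖x‖ = r → ‖L x + c‖ ≤ s) {x : E} (hx : ‖x‖ = r) : ‖L x‖ ≤ s := by
  have h₁ := h x hx
  have h₂ := h (-x) (by rwa [norm_neg])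
  have h₃ : (2 : ℝ) • L x = (L x + c) - (L (-x) + c) := by rw [map_neg, two_smul]; abel
  have h₄ := norm_sub_le (L x + c) (L (-x) + c)
  rw [← h₃, norm_smul, Real.norm_ofNat] at h₄
  linarith

/-- A linear map of `ℝⁿ` sending the sphere of radius `n / a` into the ball of radius `s`
has determinant at most `aⁿ e^{s - n}`. -/
theorem abs_det_le_pow_mul_exp {n : ℕ} (L : En n →ₗ[ℝ] En n) {a s : ℝ} (ha : 0 < a)
    (hL : ∀ x, ‖x‖ = (n : ℝ) / a → ‖L x‖ ≤ s) :
    |LinearMap.det L| ≤ a ^ n * Real.exp (s - n) := by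
  rcases Nat.eq_zero_or_pos n with rfl | hn
  · have hs : 0 ≤ s := (norm_nonneg _).trans (hL 0 (by simp))
    have hdet : LinearMap.det L = 1 := LinearMap.det_eq_one_of_finrank_eq_zero (by simp) L
    simpa [hdet] using hs
  · have hn' : (0 : ℝ) < n := Nat.cast_pos.2 hn
    have hr : 0 < (n : ℝ) / a := by positivity
    have : Nonempty (Fin n) := ⟨⟨0, hn⟩⟩
    obtain ⟨u, hu⟩ := exists_norm_eq (En n) hr.le
    have hs : 0 ≤ s := (norm_nonneg _).trans (hL u hu)
    have hC : ∀ x, ‖L x‖ ≤ a * (s / n) * ‖x‖ := by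
      intro x
      rcases eq_or_ne x 0 with rfl | hx
      · simp
      have hx' : 0 < ‖x‖ := norm_pos_iff.2 hx
      have h := hL (((n : ℝ) / a / ‖x‖) • x) (by
        rw [norm_smul, Real.norm_of_nonneg (by positivity), div_mul_cancel₀ _ hx'.ne'])
      rw [map_smul, norm_smul, Real.norm_of_nonneg (by positivity)] at h
      calc ‖L x‖ = a / n * ‖x‖ * ((n : ℝ) / a / ‖x‖ * ‖L x‖) := by field_simp
        _ ≤ a / n * ‖x‖ * s := by gcongr
        _ = a * (s / n) * ‖x‖ := by ring
    have hdet := abs_det_le_pow_finrank L (by positivity) hC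
    rw [finrank_euclideanSpace_fin, mul_pow] at hdet
    refine hdet.trans ?_
    have hexp : s / n ≤ Real.exp (s / n - 1) := by
      linarith [Real.add_one_le_exp (s / n - 1)]
    calc a ^ n * (s / n) ^ n ≤ a ^ n * Real.exp (s / n - 1) ^ n := by gcongr
      _ = a ^ n * Real.exp (s - n) := by
        rw [← Real.exp_nat_mul, mul_sub, mul_div_cancel₀ _ hn'.ne', mul_one]

/-- for a rotationally invariant log-concave function
`f(x) = e^{-φ(‖x‖)}` with `φ` convex, if `a > 0` satisfies `a = φ′(n/a)` and
`t₀ = n - φ(n/a)`, then `L(f)(x) = e^{-a‖x‖ + n - φ(n/a)}`; i.e. `(a·Id, t₀)`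
majorizes `f` and minimizes the integral among all majorizing pairs. -/
theorem lowner_function_rotation_invariant {n : ℕ}
    (φ : ℝ → ℝ) (hφ : ConvexOn ℝ Set.univ φ)
    (f : En n → ℝ) (hf : ∀ x, f x = Real.exp (-φ ‖x‖))
    (hint : Integrable f)
    (hnd : (interior {x | 0 < f x}).Nonempty)
    (a : ℝ) (ha : 0 < a)
    (hderiv : deriv φ ((n : ℝ) / a) = a)
    (t₀ : ℝ) (ht₀ : t₀ = (n : ℝ) - φ ((n : ℝ) / a)) :
    (∀ x : En n, f x ≤ Real.exp (t₀ - a * ‖x‖)) ∧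
    (∀ (T : Matrix (Fin n) (Fin n) ℝ) (c : En n) (t : ℝ), T.det ≠ 0 →
      (∀ x : En n, f x ≤ Real.exp (t - ‖Matrix.toEuclideanLin T x + c‖)) →
      (∫ x : En n, Real.exp (t₀ - a * ‖x‖)) ≤
        ∫ x : En n, Real.exp (t - ‖Matrix.toEuclideanLin T x + c‖)) := by
  have hdiff : HasDerivAt φ a ((n : ℝ) / a) := by
    have h : DifferentiableAt ℝ φ ((n : ℝ) / a) :=
      differentiableAt_of_deriv_ne_zero (by rw [hderiv]; exact ha.ne')
    simpa only [hderiv] using h.hasDerivAt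
  refine ⟨fun x => ?_, fun T c t hT hmaj => ?_⟩
  · rw [hf, Real.exp_le_exp, ht₀]
    have h := hφ.tangent_le_of_hasDerivAt hdiff ‖x‖
    rw [mul_sub, mul_div_cancel₀ _ ha.ne'] at h
    linarith
  · have hdetT : LinearMap.det (Matrix.toEuclideanLin T) = T.det := LinearMap.det_toLpLin 2 T
    have hsphere : ∀ x : En n, ‖x‖ = (n : ℝ) / a →
        ‖Matrix.toEuclideanLin T x + c‖ ≤ t + φ ((n : ℝ) / a) := by
      intro x hx
      have h := hmaj x
      rw [hf, Real.exp_le_exp, hx] at h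
      linarith
    have hdet := abs_det_le_pow_mul_exp (Matrix.toEuclideanLin T) ha
      fun x hx => norm_le_of_norm_add_le _ c hsphere hx
    rw [hdetT] at hdet
    set K : ℝ := ∫ x : En n, Real.exp (-‖x‖) with hK
    have hK₀ : 0 ≤ K := integral_nonneg fun x => (Real.exp_pos _).le
    have hleft : ∫ x : En n, Real.exp (t₀ - a * ‖x‖) = Real.exp t₀ * ((a ^ n)⁻¹ * K) := by
      have h := Measure.integral_comp_smul (volume : Measure (En n))
        (fun x => Real.exp (-‖x‖)) a
      rw [finrank_euclideanSpace_fin, abs_of_pos (by positivity), smul_eq_mul] at h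
      rw [hK, ← h, ← integral_const_mul]
      simp_rw [norm_smul, Real.norm_of_nonneg ha.le, ← Real.exp_add, ← sub_eq_add_neg]
    have hright : ∫ x : En n, Real.exp (t - ‖Matrix.toEuclideanLin T x + c‖) =
        Real.exp t * (|T.det|⁻¹ * K) := by
      have h := integral_comp_linearMap_add (volume : Measure (En n))
        (L := Matrix.toEuclideanLin T) (by rwa [hdetT]) c
        (g := fun x => Real.exp (-‖x‖)) (by fun_prop)
      rw [hdetT] at h
      rw [hK, ← h, ← integral_const_mul]
      simp_rw [← Real.exp_add, ← sub_eq_add_neg]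
    rw [hleft, hright, ← mul_assoc, ← mul_assoc]
    refine mul_le_mul_of_nonneg_right ?_ hK₀
    rw [← div_eq_mul_inv, ← div_eq_mul_inv, div_le_div_iff₀ (by positivity) (by positivity)]
    calc Real.exp t₀ * |T.det|
        ≤ Real.exp t₀ * (a ^ n * Real.exp (t + φ ((n : ℝ) / a) - n)) := by gcongr
      _ = Real.exp t * a ^ n := by
        rw [mul_left_comm, ← Real.exp_add, mul_comm, ht₀]
        congr 2
        ring
end
end
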